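/- For every n ≥ 4, the NPB Active Player Draft mechanism is not strategy-proof: there exist a preference profile ≻, a club i, and a strict linear order ≻'_i on N such that f_i(≻'_i, ≻_{-i}) ≻_i f_i(≻), where f denotes the mechanism's assignment. -/

import Mathlib

open scoped Classical

/-- Each division has a strict linear (total) preference order over workers. -/
def StrictProfile {α : Type*} (pref : α → α → α → Prop) : Prop :=
  ∀ i, IsStrictTotalOrder α (pref i)

/-- `pref'` is an improvement for division `i` with respect to `pref`. -/
def Improvement {α : Type*} (pref pref' : α → α → α → Prop) (i : α) : Prop :=
  pref' i = pref i ∧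
  (∀ j, j ≠ i → ∀ k, k ≠ i → pref j i k → pref' j i k) ∧
  (∀ j, j ≠ i → ∀ k, k ≠ i → ∀ l, l ≠ i → (pref j k l ↔ pref' j k l))

/-- The `r`-maximum element of the finite set `s` (chosen via Hilbert choice):
the element of `s` that `r`-beats every other element of `s`. -/
noncomputable def pick {α : Type*} [Nonempty α] (r : α → α → Prop) (s : Finset α) : α :=
  Classical.epsilon fun m => m ∈ s ∧ ∀ x ∈ s, x ≠ m → r m x

/-- `μ` is CE-efficient at `pref`: no derangement (complete-exchange assignment)
`μ'` weakly improves every division and strictly improves some division. -/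
def CEEfficientAt {α : Type*} (pref : α → α → α → Prop) (μ : α → α) : Prop :=
  ¬ ∃ μ' : α → α, Function.Bijective μ' ∧ (∀ i, μ' i ≠ i) ∧
      (∀ i, μ' i = μ i ∨ pref i (μ' i) (μ i)) ∧ (∃ j, pref j (μ' j) (μ j))

/-- An arbitrary element of `s` (via choice); used for the last-two rule where the
relevant set is a singleton. -/
noncomputable def theElem {α : Type*} [Nonempty α] (s : Finset α) : α :=
  Classical.epsilon (· ∈ s)

/-- One selection step of the NPB Active Player Draft.  `cur` is the club whose turn
it is, `R` the clubs without a selection yet (including `cur`), `A` the available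
players, `μ` the partial assignment.  If exactly two clubs remain, `cur` must select
the other remaining club's listed player (last-two rule); otherwise if `cur`'s voted
player is available it must select it (vote-binding); otherwise it selects its most
preferred available player other than its own.  The next mover is the owner of the
selected player if that club has not yet selected (owner-call), and otherwise the
draft-priority-maximal club without a selection (fallback). -/
noncomputable def npbStep {n : ℕ} [NeZero n] (pref : Fin n → Fin n → Fin n → Prop)
    (dprio : Fin n → Fin n → Prop) (vote : Fin n → Fin n) :
    ℕ → Fin n → Finset (Fin n) → Finset (Fin n) → (Fin n → Fin n) → (Fin n → Fin n)
  | 0, _, _, _, μ => μ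
  | fuel + 1, cur, R, A, μ =>
    let w : Fin n :=
      if R.card = 2 then theElem (R.erase cur)
      else if vote cur ∈ A then vote cur
      else pick (pref cur) (A.erase cur)
    let R' := R.erase cur
    let next := if w ∈ R' then w else pick dprio R'
    npbStep pref dprio vote fuel next R' (A.erase w) (Function.update μ cur w)

/-- The NPB Active Player Draft mechanism on clubs `{1, …, n}` (identified with
`Fin n`, each club listing its own player) with exogenous tie-break order
`1 ▷ 2 ▷ ⋯ ▷ n`.  Each club votes for its most preferred player other than its own;
the draft-priority ranks clubs by the number of votes their listed player received,
ties broken by the exogenous order; then clubs select sequentially starting from the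
draft-priority-maximal club. -/
noncomputable def npb {n : ℕ} [NeZero n]
    (pref : Fin n → Fin n → Fin n → Prop) : Fin n → Fin n :=
  let vote : Fin n → Fin n := fun i => pick (pref i) (Finset.univ.erase i)
  let votes : Fin n → ℕ := fun c => (Finset.univ.filter fun i => vote i = c).card
  let dprio : Fin n → Fin n → Prop :=
    fun i j => votes j < votes i ∨ (votes i = votes j ∧ i < j)
  npbStep pref dprio vote n (pick dprio Finset.univ) Finset.univ Finset.univ
    (fun a => a)

/-- Rank function with `a` on top, then `b`, then the rest in index order. -/
def rk {n : ℕ} (a b x : Fin n) : ℕ := if x = a then 0 else if x = b then 1 else x.val + 2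

/-- The preference with `a` on top, then `b`, then the rest. -/
def P {n : ℕ} (a b x y : Fin n) : Prop := rk a b x < rk a b y

lemma rk_inj {n : ℕ} (a b : Fin n) : Function.Injective (rk a b) := by
  intro x y h
  unfold rk at h
  split_ifs at h <;> omega

lemma P_total {n : ℕ} (a b : Fin n) : IsStrictTotalOrder (Fin n) (P a b) :=
  { trichotomous := by
      intro x y h1 h2
      exact rk_inj a b (le_antisymm (not_lt.mp h2) (not_lt.mp h1))
    irrefl := fun x => lt_irrefl (rk a b x)
    trans := fun x y z h1 h2 => lt_trans (α := ℕ) h1 h2 }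

lemma pick_eq {α : Type*} [Nonempty α] (r : α → α → Prop) (s : Finset α) (m : α)
    (hm : m ∈ s) (h : ∀ x ∈ s, x ≠ m → r m x) (ha : ∀ x y, r x y → ¬ r y x) :
    pick r s = m := by
  have hs := Classical.epsilon_spec (p := fun m => m ∈ s ∧ ∀ x ∈ s, x ≠ m → r m x) ⟨m, hm, h⟩
  by_contra hne
  exact ha _ _ (h _ hs.1 hne) (hs.2 m hm (Ne.symm hne))

lemma P_asymm {n : ℕ} (a b x y : Fin n) (h : P a b x y) : ¬ P a b y x := by
  unfold P at *; omega

lemma pick_P {n : ℕ} [NeZero n] (a b : Fin n) (s : Finset (Fin n)) (h : a ∈ s) :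
    pick (P a b) s = a := by
  apply pick_eq _ _ _ h _ (P_asymm a b)
  intro x _ hx
  unfold P rk
  simp only [if_true, hx, if_false]
  split_ifs <;> omega

lemma pick_mem {α : Type*} [Nonempty α] (r : α → α → Prop) [IsStrictTotalOrder α r]
    (s : Finset α) (hs : s.Nonempty) : pick r s ∈ s := by
  have hex : ∃ m, m ∈ s ∧ ∀ x ∈ s, x ≠ m → r m x := by
    letI := linearOrderOfSTO r
    refine ⟨s.min' hs, s.min'_mem hs, fun x hx hne => ?_⟩
    exact lt_of_le_of_ne (s.min'_le x hx) (Ne.symm hne)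
  exact (Classical.epsilon_spec hex).1

def votesOf {n : ℕ} (vote : Fin n → Fin n) (c : Fin n) : ℕ :=
  (Finset.univ.filter fun i => vote i = c).card

def dp {n : ℕ} (vote : Fin n → Fin n) (i j : Fin n) : Prop :=
  votesOf vote j < votesOf vote i ∨ (votesOf vote i = votesOf vote j ∧ i < j)

instance dp_total {n : ℕ} (vote : Fin n → Fin n) : IsStrictTotalOrder (Fin n) (dp vote) :=
  { trichotomous := by
      intro x y h1 h2
      unfold dp at h1 h2
      apply Fin.ext
      simp only [Fin.lt_def] at h1 h2
      omega
    irrefl := by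
      intro x h
      unfold dp at h
      simp at h
    trans := by
      intro x y z h1 h2
      unfold dp at *
      simp only [Fin.lt_def] at *
      omega }

lemma pick_dp {n : ℕ} [NeZero n] (vote : Fin n → Fin n) (s : Finset (Fin n)) (m : Fin n)
    (hm : m ∈ s) (h : ∀ x ∈ s, x ≠ m → dp vote m x) : pick (dp vote) s = m :=
  pick_eq _ _ _ hm h (fun x y h1 h2 => by
    unfold dp at *
    simp only [Fin.lt_def] at *
    omega)

lemma npb_eq {n : ℕ} [NeZero n] (pref : Fin n → Fin n → Fin n → Prop) (vote : Fin n → Fin n)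
    (h : ∀ i, pick (pref i) (Finset.univ.erase i) = vote i) :
    npb pref = npbStep pref (dp vote) vote n (pick (dp vote) Finset.univ) Finset.univ Finset.univ
      (fun a => a) := by
  obtain rfl : (fun i => pick (pref i) (Finset.univ.erase i)) = vote := funext h
  rfl

lemma step_keep {n : ℕ} [NeZero n] (pref : Fin n → Fin n → Fin n → Prop)
    (dprio : Fin n → Fin n → Prop) [IsStrictTotalOrder (Fin n) dprio] (vote : Fin n → Fin n)
    (i : Fin n) (fuel : ℕ) : ∀ (cur : Fin n) (R A : Finset (Fin n)) (μ : Fin n → Fin n),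
      R.card = fuel → i ∉ R → (0 < fuel → cur ∈ R) →
      npbStep pref dprio vote fuel cur R A μ i = μ i := by
  induction fuel with
  | zero => intros; rfl
  | succ k ih =>
    intro cur R A μ hc hi hcur
    have hcR := hcur (Nat.succ_pos k)
    simp only [npbStep]
    rw [ih]
    · rw [Function.update_of_ne]
      rintro rfl
      exact hi hcR
    · rw [Finset.card_erase_of_mem hcR]; omega
    · exact fun h => hi (Finset.mem_of_mem_erase h)
    · intro hk
      have hne : (R.erase cur).Nonempty := by
        rw [← Finset.card_pos, Finset.card_erase_of_mem hcR]; omega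
      split_ifs with h1 h2 h3 h4 h5
      all_goals first | assumption | exact pick_mem dprio _ hne

/-- A club that moves keeps what it selects. -/
lemma step_self {n : ℕ} [NeZero n] (pref : Fin n → Fin n → Fin n → Prop)
    (dprio : Fin n → Fin n → Prop) [IsStrictTotalOrder (Fin n) dprio] (vote : Fin n → Fin n)
    (fuel : ℕ) (cur : Fin n) (R A : Finset (Fin n)) (μ : Fin n → Fin n)
    (hc : R.card = fuel + 1) (hcR : cur ∈ R) :
    npbStep pref dprio vote (fuel + 1) cur R A μ cur =
      if R.card = 2 then theElem (R.erase cur)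
      else if vote cur ∈ A then vote cur
      else pick (pref cur) (A.erase cur) := by
  simp only [npbStep]
  rw [step_keep]
  · rw [Function.update_self]
  · rw [Finset.card_erase_of_mem hcR]; omega
  · simp
  · intro hk
    have hne : (R.erase cur).Nonempty := by
      rw [← Finset.card_pos, Finset.card_erase_of_mem hcR]; omega
    split_ifs with h1 h2 h3 h4 h5
    all_goals first | assumption | exact pick_mem dprio _ hne

/-- A step in which the voted player is selected and its owner called. -/
lemma step_call {n : ℕ} [NeZero n] (pref : Fin n → Fin n → Fin n → Prop)
    (dprio : Fin n → Fin n → Prop) (vote : Fin n → Fin n)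
    (fuel : ℕ) (cur w next : Fin n) (R A : Finset (Fin n)) (μ : Fin n → Fin n)
    (hc : R.card ≠ 2) (hv : vote cur = w) (hA : w ∈ A)
    (hn : (if w ∈ R.erase cur then w else pick dprio (R.erase cur)) = next) :
    npbStep pref dprio vote (fuel + 1) cur R A μ =
      npbStep pref dprio vote fuel next (R.erase cur) (A.erase w) (Function.update μ cur w) := by
  subst hv
  simp only [npbStep, if_neg hc, if_pos hA, hn]

lemma theElem_singleton {α : Type*} [Nonempty α] (a : α) : theElem ({a} : Finset α) = a := by
  have h : theElem ({a} : Finset α) ∈ ({a} : Finset α) :=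
    Classical.epsilon_spec (p := (· ∈ ({a} : Finset α))) ⟨a, Finset.mem_singleton_self a⟩
  exact Finset.mem_singleton.mp h

/-- Profile with given tops and seconds. -/
lemma prof_pick {n : ℕ} [NeZero n] (top snd : Fin n → Fin n) (h : ∀ i, top i ≠ i) (i : Fin n) :
    pick (P (top i) (snd i)) (Finset.univ.erase i) = top i :=
  pick_P _ _ _ (by simp [h i])

lemma prof_pick' {n : ℕ} [NeZero n] (top snd : Fin n → Fin n) (h : ∀ i, top i ≠ i)
    (k a b : Fin n) (hk : a ≠ k) (i : Fin n) :
    pick (Function.update (fun i => P (top i) (snd i)) k (P a b) i) (Finset.univ.erase i)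
      = Function.update top k a i := by
  by_cases hi : i = k
  · subst hi
    rw [Function.update_self, Function.update_self]
    exact pick_P _ _ _ (by simp [hk])
  · rw [Function.update_of_ne hi, Function.update_of_ne hi]
    exact prof_pick top snd h i

def top4 : Fin 4 → Fin 4 := ![1, 2, 0, 0]

instance dp_dec {n : ℕ} (vote : Fin n → Fin n) (i j : Fin n) : Decidable (dp vote i j) := by
  unfold dp; infer_instance

lemma case4 : P (top4 2) 1
      (npb (Function.update (fun i => P (top4 i) 1) 2 (P 1 0)) 2)
      (npb (fun i => P (top4 i) 1) 2) := by
  have htop : ∀ i, top4 i ≠ i := by decide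
  have h1 : npb (fun i => P (top4 i) 1) 2 = 3 := by
    rw [npb_eq _ top4 (prof_pick top4 (fun _ => 1) htop),
      pick_dp top4 Finset.univ 0 (by decide) (by decide),
      step_call _ _ _ _ 0 1 1 _ _ _ (by decide) (by decide) (by decide) (if_pos (by decide)),
      step_call _ _ _ _ 1 2 2 _ _ _ (by decide) (by decide) (by decide) (if_pos (by decide)),
      step_self _ _ _ _ _ _ _ _ (by decide) (by decide), if_pos (by decide)]
    rw [show (((Finset.univ.erase 0).erase 1).erase 2 : Finset (Fin 4)) = {3} by decide]
    exact theElem_singleton 3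
  have h2 : npb (Function.update (fun i => P (top4 i) 1) 2 (P 1 0)) 2 = 1 := by
    rw [npb_eq _ (Function.update top4 2 1)
        (prof_pick' top4 (fun _ => 1) htop 2 1 0 (by decide)),
      pick_dp _ Finset.univ 1 (by decide) (by decide),
      step_call _ _ _ _ 1 2 2 _ _ _ (by decide) (by decide) (by decide) (if_pos (by decide)),
      step_self _ _ _ _ _ _ _ _ (by decide) (by decide), if_neg (by decide), if_pos (by decide)]
    decide
  rw [h1, h2]
  unfold P
  decide

/-- Tops for at least five clubs. -/
def top5 (k : ℕ) (j : Fin (k + 1 + 4)) : Fin (k + 1 + 4) :=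
  if j.val = 0 then ⟨2, by omega⟩ else if j.val ≤ 2 then ⟨0, by omega⟩
  else if j.val ≤ 4 then ⟨1, by omega⟩ else ⟨j.val - 1, by omega⟩

lemma votes_le_two {n : ℕ} (vote : Fin n → Fin n) (c a b : Fin n)
    (h : ∀ i, vote i = c → i = a ∨ i = b) : votesOf vote c ≤ 2 := by
  unfold votesOf
  refine le_trans (Finset.card_le_card (t := {a, b}) ?_) (Finset.card_le_two)
  intro i hi
  simpa using h i (by simpa using hi)

lemma votes_ge_two {n : ℕ} (vote : Fin n → Fin n) (c a b : Fin n) (hab : a ≠ b)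
    (ha : vote a = c) (hb : vote b = c) : 2 ≤ votesOf vote c := by
  unfold votesOf
  rw [← Finset.card_pair hab]
  apply Finset.card_le_card
  intro i hi
  simp only [Finset.mem_insert, Finset.mem_singleton] at hi
  rcases hi with rfl | rfl <;> simp [ha, hb]

lemma votes_le_one {n : ℕ} (vote : Fin n → Fin n) (c : Fin n)
    (h : ∀ i j, vote i = c → vote j = c → i = j) : votesOf vote c ≤ 1 := by
  unfold votesOf
  rw [Finset.card_le_one]
  intro i hi j hj
  exact h i j (by simpa using hi) (by simpa using hj)

lemma top5_val (k : ℕ) (j : Fin (k + 1 + 4)) : (top5 k j).val =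
    if j.val = 0 then 2 else if j.val ≤ 2 then 0 else if j.val ≤ 4 then 1 else j.val - 1 := by
  unfold top5; split_ifs <;> rfl

lemma case5 (k : ℕ) (z i b c d : Fin (k + 1 + 4)) (hz : z.val = 0) (hi : i.val = 1)
    (hb : b.val = 2) (hc : c.val = 3) (hd : d.val = 4) : P (top5 k i) b
      (npb (Function.update (fun i => P (top5 k i) b) i (P b z)) i)
      (npb (fun i => P (top5 k i) b) i) := by
  have hv := top5_val k
  have htop : ∀ i, top5 k i ≠ i := by
    intro j h
    have h1 := hv j
    rw [h] at h1
    split_ifs at h1 <;> omega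
  have tz : top5 k z = b := by apply Fin.ext; rw [hv, hb]; simp [hz]
  have ti : top5 k i = z := by apply Fin.ext; rw [hv, hz]; simp [hi]
  have tb : top5 k b = z := by apply Fin.ext; rw [hv, hz]; simp [hb]
  have tc : top5 k c = i := by apply Fin.ext; rw [hv, hi]; simp [hc]
  have td : top5 k d = i := by apply Fin.ext; rw [hv, hi]; simp [hd]
  have zi : z ≠ i := by rintro rfl; omega
  have zb : z ≠ b := by rintro rfl; omega
  have ib : i ≠ b := by rintro rfl; omega
  have ic : c ≠ i := by rintro rfl; omega
  have id' : d ≠ i := by rintro rfl; omega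
  have cd : c ≠ d := by rintro rfl; omega
  have hcard : (Finset.univ : Finset (Fin (k + 1 + 4))).card = k + 1 + 4 := by simp
  -- truthful vote counts
  have v0 : 2 ≤ votesOf (top5 k) z := votes_ge_two _ _ i b ib ti tb
  have v1 : 2 ≤ votesOf (top5 k) i := votes_ge_two _ _ c d cd tc td
  have v0' : votesOf (top5 k) i ≤ 2 := votes_le_two _ _ c d (by
    intro j hj
    have h1 := hv j
    rw [hj] at h1
    simp only [Fin.ext_iff]
    split_ifs at h1 <;> omega)
  have vx : ∀ x, x ≠ z → x ≠ i → votesOf (top5 k) x ≤ 1 := by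
    intro x hxz hxi
    apply votes_le_one
    intro j l hj hl
    have h1 := hv j
    have h2 := hv l
    rw [hj] at h1
    rw [hl] at h2
    rw [Ne, Fin.ext_iff] at hxz hxi
    apply Fin.ext
    split_ifs at h1 h2 <;> omega
  -- truthful outcome
  have h1 : npb (fun i => P (top5 k i) b) i ≠ z ∧ npb (fun i => P (top5 k i) b) i ≠ b := by
    rw [npb_eq _ (top5 k) (prof_pick (top5 k) (fun _ => b) htop),
      pick_dp (top5 k) Finset.univ z (Finset.mem_univ _) (by
        intro x _ hx
        unfold dp
        by_cases hxi : x = i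
        · subst hxi
          rw [Fin.lt_def]; omega
        · have := vx x hx hxi
          left; omega),
      step_call _ _ _ _ z b b _ _ _ (by rw [hcard]; omega) tz (Finset.mem_univ _)
        (if_pos (by simp [zb.symm])),
      step_call _ _ _ _ b z i _ _ _
        (by rw [Finset.card_erase_of_mem (Finset.mem_univ _), hcard]; omega) tb (by simp [zb])
        (by
          rw [if_neg (by simp)]
          apply pick_dp _ _ _ (by simp [ib, zi.symm])
          intro x hx hxi
          have hxz : x ≠ z := by rintro rfl; simp at hx
          have := vx x hxz hxi
          unfold dp
          left; omega)]
    have hcR : ((Finset.univ.erase z).erase b : Finset (Fin (k + 1 + 4))).card = k + 3 := by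
      rw [Finset.card_erase_of_mem (by simp [zb.symm]),
        Finset.card_erase_of_mem (Finset.mem_univ _), hcard]
      omega
    rw [step_self _ _ _ _ _ _ _ _ (by rw [hcR]) (by simp [ib, zi.symm]),
      if_neg (by rw [hcR]; omega), if_neg (by simp [ti])]
    haveI := P_total (top5 k i) b
    have hm := pick_mem (P (top5 k i) b) (((Finset.univ.erase b).erase z).erase i)
      ⟨c, by simp [Fin.ext_iff, hc, hz, hb, hi]⟩
    simp only [Finset.mem_erase] at hm
    exact ⟨hm.2.1, hm.2.2.1⟩
  have h2 : npb (Function.update (fun i => P (top5 k i) b) i (P b z)) i = b := by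
    have hu : ∀ j, j ≠ i → Function.update (top5 k) i b j = top5 k j :=
      fun j hj => Function.update_of_ne hj _ _
    have w1 : 2 ≤ votesOf (Function.update (top5 k) i b) i :=
      votes_ge_two _ _ c d cd (by rw [hu c ic, tc]) (by rw [hu d id', td])
    have wb : votesOf (Function.update (top5 k) i b) b ≤ 2 := votes_le_two _ _ z i (by
      intro j hj
      by_cases hji : j = i
      · exact Or.inr hji
      · left
        rw [hu j hji] at hj
        have h1 := hv j
        rw [hj] at h1
        apply Fin.ext
        split_ifs at h1 <;> omega)
    have wx : ∀ x, x ≠ i → x ≠ b → votesOf (Function.update (top5 k) i b) x ≤ 1 := by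
      intro x hxi hxb
      apply votes_le_one
      intro j l hj hl
      have hji : j ≠ i := by
        rintro rfl
        rw [Function.update_self] at hj
        exact hxb hj.symm
      have hli : l ≠ i := by
        rintro rfl
        rw [Function.update_self] at hl
        exact hxb hl.symm
      rw [hu _ hji] at hj
      rw [hu _ hli] at hl
      have h1 := hv j
      have h2 := hv l
      rw [hj] at h1
      rw [hl] at h2
      rw [Ne, Fin.ext_iff] at hxi hxb hji hli
      apply Fin.ext
      split_ifs at h1 h2 <;> omega
    rw [npb_eq _ (Function.update (top5 k) i b)
        (prof_pick' (top5 k) (fun _ => b) htop i b z ib.symm),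
      pick_dp _ Finset.univ i (Finset.mem_univ _) (by
        intro x _ hx
        unfold dp
        by_cases hxb : x = b
        · subst hxb
          rw [Fin.lt_def]; omega
        · have := wx x hx hxb
          left; omega),
      step_self _ _ _ _ _ _ _ _ (by rw [hcard]) (Finset.mem_univ _),
      if_neg (by rw [hcard]; omega), if_pos (Finset.mem_univ _), Function.update_self]
  rw [h2, ti]
  generalize npb (fun i => P (top5 k i) b) i = y at h1 ⊢
  unfold P rk
  rw [if_neg zb.symm, if_pos rfl, if_neg h1.1, if_neg h1.2]
  omega

/-- For every `n ≥ 4` (here `n = m + 4`), the NPB Active Player Draft mechanism is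
not strategy-proof: there are a strict profile, a club `i` and a strict misreport
`q` of `i` such that `i` strictly prefers the outcome under the misreport. -/
theorem npb_not_strategyproof (m : ℕ) :
    ∃ (pref : Fin (m + 4) → Fin (m + 4) → Fin (m + 4) → Prop) (i : Fin (m + 4))
      (q : Fin (m + 4) → Fin (m + 4) → Prop),
      StrictProfile pref ∧ IsStrictTotalOrder (Fin (m + 4)) q ∧
      pref i (npb (Function.update pref i q) i) (npb pref i) := by
  cases m with
  | zero =>
    exact ⟨fun i => P (top4 i) 1, 2, P 1 0, fun i => P_total _ _, P_total _ _, case4⟩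
  | succ k =>
    exact ⟨fun i => P (top5 k i) ⟨2, by omega⟩, ⟨1, by omega⟩, P ⟨2, by omega⟩ ⟨0, by omega⟩,
      fun i => P_total _ _, P_total _ _,
      case5 k ⟨0, by omega⟩ ⟨1, by omega⟩ ⟨2, by omega⟩ ⟨3, by omega⟩ ⟨4, by omega⟩
        rfl rfl rfl rfl rfl⟩
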